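/- For a DMC with capacity-achieving distribution P_X, Gallager's random coding error exponent satisfies E_p(R) ≥ (C−R)²/(8/e² + 4(ln|Y|)²) for all rates R in [0, C], where C is the channel capacity in nats and |Y| is the size of the output alphabet. -/

import Mathlib

open scoped BigOperators

theorem sub_one_sub_log_le_sq {t : ℝ} (ht : 1 ≤ t) :
    t - 1 - Real.log t ≤ (21 / 200) * t ^ 2 := by
  have key : ∀ {u : ℝ}, 1 ≤ u → 2 * (u - 1) / (u + 1) ≤ Real.log u := fun {u} hu => by
    have h := Real.le_log_one_add_of_nonneg (sub_nonneg.2 hu)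
    convert h using 2 <;> ring
  rcases le_total t (5 / 2) with h | h
  · have h1 := key ht
    have h2 : t - 1 - (21 / 200) * t ^ 2 ≤ 2 * (t - 1) / (t + 1) := by
      rw [le_div_iff₀ (by linarith)]
      nlinarith [sq_nonneg (t - 2), mul_nonneg (sub_nonneg.2 ht) (sub_nonneg.2 h),
        mul_nonneg (mul_nonneg (sub_nonneg.2 ht) (sub_nonneg.2 h)) (sub_nonneg.2 ht)]
    linarith
  · have h1 := key (u := t / (5 / 2)) (by rw [le_div_iff₀] <;> linarith)
    have h3 := key (u := (5 / 4)) (by norm_num)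
    have h4 : Real.log t = Real.log 2 + Real.log (5 / 4) + Real.log (t / (5 / 2)) := by
      rw [← Real.log_mul (by norm_num) (by norm_num), ← Real.log_mul (by norm_num) (by positivity)]
      congr 1; ring
    have h5 := Real.log_two_gt_d9
    have h2 : t - 1 - (21 / 200) * t ^ 2 - 183 / 200 ≤ 2 * (t / (5 / 2) - 1) / (t / (5 / 2) + 1) := by
      rw [le_div_iff₀ (by positivity)]
      nlinarith [mul_nonneg (sub_nonneg.2 h) (sq_nonneg (t - 33 / 10)), sq_nonneg (t - 67 / 20)]
    linarith

theorem exp_mul_le_quadratic {s w : ℝ} (hs0 : 0 ≤ s) (hs1 : s ≤ 1) (hw : 0 ≤ w) :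
    Real.exp (s * w) ≤ 1 + s * w + s ^ 2 * (Real.exp w - 1 - w) := by
  have key : ∀ z : ℝ, HasSum (fun k : ℕ => z ^ (k + 2) / ((k + 2).factorial : ℝ))
      (Real.exp z - 1 - z) := fun z => by
    have h := (hasSum_nat_add_iff' 2).2 (NormedSpace.expSeries_div_hasSum_exp z)
    rw [← Real.exp_eq_exp_ℝ] at h
    simpa [Finset.sum_range_succ, sub_add_eq_sub_sub] using h
  have h := hasSum_le (fun k => ?_) (key (s * w)) ((key w).mul_left (s ^ 2))
  · linarith
  · rw [mul_pow, pow_add s, ← mul_div_assoc]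
    gcongr ?_ / _
    have := pow_le_one₀ hs0 hs1 (n := k)
    have h2 : 0 ≤ s ^ 2 * w ^ (k + 2) := by positivity
    nlinarith

theorem sq_le_exp_sub_one {m : ℝ} (hm : 0 ≤ m) : m ^ 2 ≤ (131 / 200) * (Real.exp m - 1) := by
  have h := Real.sum_le_exp_of_nonneg hm 7
  simp [Finset.sum_range_succ, Nat.factorial] at h
  have hp : 0 ≤ 1 + m / 2 + m ^ 2 / 6 + m ^ 3 / 24 + m ^ 4 / 120 + m ^ 5 / 720 - m / (131 / 200) := by
    nlinarith [mul_nonneg hm (sq_nonneg (m - 8 / 5)), sq_nonneg (m ^ 2 - 64 / 25),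
      sq_nonneg (m - 8 / 5), mul_nonneg hm (sq_nonneg (m ^ 2 - 64 / 25))]
  have := mul_nonneg hm hp
  linarith

theorem sq_le_tangent {L m : ℝ} (hL : 2 ≤ L) (hm : 0 ≤ m) :
    m ^ 2 ≤ L ^ 2 - 2 * L + 2 * L * Real.exp (m - L) := by
  suffices h : (m - L) ^ 2 ≤ 2 * L * (Real.exp (m - L) - 1 - (m - L)) by nlinarith
  have hpos : 0 ≤ Real.exp (m - L) - 1 - (m - L) := by
    linarith [Real.add_one_le_exp (m - L)]
  rcases le_total L m with h | h
  · nlinarith [Real.quadratic_le_exp_of_nonneg (sub_nonneg.2 h)]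
  · rcases le_total (L - m) 2 with h2 | h2
    · have h3 := Real.add_one_le_exp ((m - L) / 2)
      have h4 : Real.exp (m - L) = Real.exp ((m - L) / 2) ^ 2 := by
        rw [← Real.exp_nat_mul]; congr 1; push_cast; ring
      nlinarith
    · nlinarith [Real.exp_pos (m - L)]

theorem exp_neg_le_quadratic {z : ℝ} (hz : 0 ≤ z) : Real.exp (-z) ≤ 1 - z + z ^ 2 / 2 := by
  have h := Real.quadratic_le_exp_of_nonneg hz
  have h1 : Real.exp (-z) * Real.exp z = 1 := by rw [← Real.exp_add]; simp
  have h2 := Real.exp_pos (-z)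
  have h3 : Real.exp (-z) * (1 + z + z ^ 2 / 2) ≤ 1 := by nlinarith
  have h4 : 0 < 1 + z + z ^ 2 / 2 := by positivity
  by_contra! hlt
  nlinarith [sq_nonneg (z ^ 2), mul_lt_mul_of_pos_right hlt h4]

theorem mul_rpow_neg_le {w q ρ : ℝ} (hw0 : 0 ≤ w) (hw1 : w ≤ 1) (hq : 0 < q)
    (h0 : 0 ≤ ρ) (h1 : ρ ≤ 1 / 2) :
    w * (w / q) ^ (-ρ) ≤ w - ρ * (w * Real.log (w / q))
      + ρ ^ 2 / 2 * (21 / 25 * q + w * Real.log q ^ 2) := by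
  rcases hw0.eq_or_lt with rfl | hw
  · simp only [zero_mul, mul_zero, sub_zero, zero_add, add_zero]
    positivity
  have ht : 0 < w / q := by positivity
  rw [Real.rpow_def_of_pos ht]
  have hexp : w * Real.exp (-Real.log (w / q)) = q := by
    rw [Real.exp_neg, Real.exp_log ht]; field_simp
  have hlog : Real.log (w / q) = Real.log w - Real.log q := Real.log_div hw.ne' hq.ne'
  have hlw : Real.log w ≤ 0 := Real.log_nonpos hw0 hw1
  set l := Real.log (w / q)
  rcases le_total 0 l with hl | hl
  · have h := exp_neg_le_quadratic (mul_nonneg h0 hl)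
    have h2 : l ^ 2 ≤ Real.log q ^ 2 := by nlinarith
    rw [show l * -ρ = -(ρ * l) by ring]
    have h3 := mul_le_mul_of_nonneg_left h hw0
    have h4 : ρ ^ 2 / 2 * (w * l ^ 2) ≤ ρ ^ 2 / 2 * (w * Real.log q ^ 2) := by gcongr
    have h5 : 0 ≤ ρ ^ 2 / 2 * (21 / 25 * q) := by positivity
    nlinarith
  · have h := exp_mul_le_quadratic (s := 2 * ρ) (w := -l / 2) (by linarith) (by linarith)
      (by linarith)
    have h2 := sub_one_sub_log_le_sq (t := Real.exp (-l / 2)) (Real.one_le_exp (by linarith))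
    rw [Real.log_exp, ← Real.exp_nat_mul, show ((2 : ℕ) : ℝ) * (-l / 2) = -l by push_cast; ring]
      at h2
    rw [show l * -ρ = 2 * ρ * (-l / 2) by ring]
    have h3 : Real.exp (2 * ρ * (-l / 2)) ≤
        1 - ρ * l + (2 * ρ) ^ 2 * (21 / 200 * Real.exp (-l)) := by
      have := mul_le_mul_of_nonneg_left h2 (sq_nonneg (2 * ρ))
      linarith
    have h4 := mul_le_mul_of_nonneg_left h3 hw0
    have h5 : 0 ≤ ρ ^ 2 / 2 * (w * Real.log q ^ 2) := by positivity
    have h6 : w * (1 - ρ * l + (2 * ρ) ^ 2 * (21 / 200 * Real.exp (-l))) =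
      w - ρ * (w * l) + ρ ^ 2 / 2 * (21 / 25 * (w * Real.exp (-l))) := by ring
    rw [h6, hexp] at h4
    linarith

theorem four_div_exp_one_sq_ge : (541 / 1000 : ℝ) ≤ 4 / Real.exp 1 ^ 2 := by
  rw [le_div_iff₀ (by positivity)]
  nlinarith [Real.exp_one_lt_d9, Real.exp_pos 1]

theorem mul_log_sq_le {q : ℝ} (h0 : 0 ≤ q) (h1 : q ≤ 1) :
    q * Real.log q ^ 2 ≤ 131 / 200 * (1 - q) := by
  rcases h0.eq_or_lt with rfl | hq
  · norm_num
  have h := mul_le_mul_of_nonneg_left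
    (sq_le_exp_sub_one (m := -Real.log q) (by linarith [Real.log_nonpos h0 h1])) h0
  rw [Real.exp_neg, Real.exp_log hq] at h
  have : q * q⁻¹ = 1 := mul_inv_cancel₀ hq.ne'
  nlinarith

theorem mul_log_sq_le_tangent {q n : ℝ} (h0 : 0 ≤ q) (h1 : q ≤ 1) (hn : 2 ≤ Real.log n)
    (hn0 : 0 < n) :
    q * Real.log q ^ 2 ≤ q * (Real.log n ^ 2 - 2 * Real.log n) + 2 * Real.log n / n := by
  rcases h0.eq_or_lt with rfl | hq
  · simp only [zero_mul, zero_add]; positivity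
  have h := mul_le_mul_of_nonneg_left
    (sq_le_tangent (m := -Real.log q) hn (by linarith [Real.log_nonpos h0 h1])) h0
  rw [Real.exp_sub, Real.exp_neg, Real.exp_log hq, Real.exp_log hn0] at h
  have : q * (2 * Real.log n * (q⁻¹ / n)) = 2 * Real.log n / n := by field_simp
  nlinarith

theorem sum_mul_log_sq_le {Y : Type*} [Fintype Y] {Q : Y → ℝ} (hQ0 : ∀ y, 0 ≤ Q y)
    (hQ1 : ∑ y, Q y = 1) (hcard : 2 ≤ Fintype.card Y) :
    21 / 25 + ∑ y, Q y * Real.log (Q y) ^ 2 ≤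
      4 / Real.exp 1 ^ 2 + 2 * Real.log (Fintype.card Y) ^ 2 := by
  have hle : ∀ y, Q y ≤ 1 := fun y =>
    hQ1 ▸ Finset.single_le_sum (fun y _ => hQ0 y) (Finset.mem_univ y)
  have he := four_div_exp_one_sq_ge
  have hl2 := Real.log_two_gt_d9
  have hmono : ∀ a b : ℝ, 0 < a → a ≤ b → Real.log a ≤ Real.log b := fun a b => Real.log_le_log
  have hn0 : (0 : ℝ) < Fintype.card Y := by positivity
  rcases le_total 2 (Real.log (Fintype.card Y)) with hL | hL
  · have h : ∑ y, Q y * Real.log (Q y) ^ 2 ≤ _ :=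
      Finset.sum_le_sum fun y _ => mul_log_sq_le_tangent (hQ0 y) (hle y) hL hn0
    rw [Finset.sum_add_distrib, ← Finset.sum_mul, hQ1, Finset.sum_const, Finset.card_univ,
      nsmul_eq_mul, mul_div_cancel₀ _ hn0.ne'] at h
    nlinarith
  · have h : ∑ y, Q y * Real.log (Q y) ^ 2 ≤ _ :=
      Finset.sum_le_sum fun y _ => mul_log_sq_le (hQ0 y) (hle y)
    rw [← Finset.mul_sum, Finset.sum_sub_distrib, hQ1, Finset.sum_const, Finset.card_univ,
      nsmul_eq_mul, mul_one] at h
    have h4 : Real.log 4 = 2 * Real.log 2 := by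
      rw [show (4 : ℝ) = 2 ^ 2 by norm_num, Real.log_pow]; norm_num
    have h8 : Real.log 8 = 3 * Real.log 2 := by
      rw [show (8 : ℝ) = 2 ^ 3 by norm_num, Real.log_pow]; norm_num
    have h3 : 1 ≤ Real.log 3 := by
      rw [Real.le_log_iff_exp_le (by norm_num)]; linarith [Real.exp_one_lt_d9]
    have h6 : Real.log 6 = Real.log 2 + Real.log 3 := by
      rw [← Real.log_mul (by norm_num) (by norm_num)]; norm_num
    have hlt : Fintype.card Y < 8 := by
      by_contra! hge
      have := hmono 8 (Fintype.card Y) (by norm_num) (by exact_mod_cast hge)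
      linarith
    generalize Fintype.card Y = n at *
    interval_cases n <;> push_cast at *
    · nlinarith
    · nlinarith
    · nlinarith
    · nlinarith [hmono 4 5 (by norm_num) (by norm_num)]
    · nlinarith
    · nlinarith [hmono 6 7 (by norm_num) (by norm_num)]

theorem sum_mul_log_div_le {X Y : Type*} [Fintype X] [Fintype Y] {W : X → Y → ℝ}
    (hW0 : ∀ x y, 0 ≤ W x y) (hW1 : ∀ x, ∑ y, W x y = 1)
    {P : X → ℝ} (hP0 : ∀ x, 0 ≤ P x)
    (hQ1 : ∑ y, ∑ x, P x * W x y = 1) (hcard : 0 < Fintype.card Y) :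
    ∑ x, ∑ y, P x * W x y * Real.log (W x y / ∑ x', P x' * W x' y) ≤
      Real.log (Fintype.card Y) := by
  have hn : (0 : ℝ) < Fintype.card Y := by exact_mod_cast hcard
  have hWle : ∀ x y, W x y ≤ 1 := fun x y =>
    hW1 x ▸ Finset.single_le_sum (fun y _ => hW0 x y) (Finset.mem_univ y)
  rw [Finset.sum_comm]
  have hy : ∀ y, ∑ x, P x * W x y * Real.log (W x y / ∑ x', P x' * W x' y) ≤
      (∑ x, P x * W x y) * (Real.log (Fintype.card Y) - 1) + 1 / Fintype.card Y := by
    intro y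
    set Q := ∑ x, P x * W x y with hQ
    have hQ0 : 0 ≤ Q := Finset.sum_nonneg fun x _ => mul_nonneg (hP0 x) (hW0 x y)
    have hx : ∀ x, P x * W x y * Real.log (W x y / Q) ≤
        P x * W x y * (Real.log (Fintype.card Y) - 1 + 1 / (Q * Fintype.card Y)) := by
      intro x
      rcases (mul_nonneg (hP0 x) (hW0 x y)).eq_or_lt with h | h
      · simp [← h]
      have hWp : 0 < W x y := pos_of_mul_pos_right h (hP0 x)
      have hQp : 0 < Q := h.trans_le <|
        Finset.single_le_sum (f := fun x => P x * W x y)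
          (fun x _ => mul_nonneg (hP0 x) (hW0 x y)) (Finset.mem_univ x)
      refine mul_le_mul_of_nonneg_left ?_ h.le
      have h1 : Real.log (W x y / Q) =
          Real.log (Fintype.card Y) + Real.log (W x y / (Q * Fintype.card Y)) := by
        rw [← Real.log_mul hn.ne' (by positivity)]
        congr 1; field_simp
      have h2 := Real.log_le_sub_one_of_pos (x := W x y / (Q * Fintype.card Y)) (by positivity)
      have h3 : W x y / (Q * Fintype.card Y) ≤ 1 / (Q * Fintype.card Y) := by
        gcongr; exact hWle x y
      linarith
    refine (Finset.sum_le_sum fun x _ => hx x).trans ?_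
    rw [← Finset.sum_mul, ← hQ, mul_add]
    gcongr
    rcases hQ0.eq_or_lt with h | h
    · rw [← h]; simp
    · apply le_of_eq; field_simp
  refine (Finset.sum_le_sum fun y _ => hy y).trans (le_of_eq ?_)
  rw [Finset.sum_add_distrib, ← Finset.sum_mul, hQ1, Finset.sum_const, Finset.card_univ,
    nsmul_eq_mul, mul_one_div_cancel hn.ne']
  ring

/-- By convexity, a tilted average is at most the moment generating function of the information
density. -/
theorem rpow_sum_le_sum_mul_rpow {X : Type*} [Fintype X] {P w : X → ℝ} (hP : ∀ x, 0 ≤ P x)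
    (hw : ∀ x, 0 ≤ w x) {ρ : ℝ} (hρ : 0 ≤ ρ) (hq : 0 < ∑ x, P x * w x) :
    (∑ x, P x * w x ^ (1 / (1 + ρ))) ^ (1 + ρ) ≤
      ∑ x, P x * (w x * (w x / ∑ x', P x' * w x') ^ (-ρ)) := by
  set q := ∑ x, P x * w x with hqdef
  have hρ1 : 0 < 1 + ρ := by linarith
  have hJ := Real.rpow_arith_mean_le_arith_mean_rpow Finset.univ (fun x => P x * w x / q)
    (fun x => (w x / q) ^ (1 / (1 + ρ) - 1))
    (fun x _ => div_nonneg (mul_nonneg (hP x) (hw x)) hq.le)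
    (by rw [← Finset.sum_div, ← hqdef, div_self hq.ne'])
    (fun x _ => Real.rpow_nonneg (div_nonneg (hw x) hq.le) _) (p := 1 + ρ) (by linarith)
  have hL : ∑ x, P x * w x ^ (1 / (1 + ρ)) =
      q ^ (1 / (1 + ρ)) * ∑ x, P x * w x / q * (w x / q) ^ (1 / (1 + ρ) - 1) := by
    rw [Finset.mul_sum]
    refine Finset.sum_congr rfl fun x _ => ?_
    rcases (hw x).eq_or_lt with h | h
    · rw [← h, Real.zero_rpow (by positivity)]; simp
    · have ht : 0 < w x / q := by positivity
      rw [Real.rpow_sub_one ht.ne', Real.div_rpow h.le hq.le]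
      have : 0 < q ^ (1 / (1 + ρ)) := by positivity
      field_simp
  have hnn : 0 ≤ ∑ x, P x * w x / q * (w x / q) ^ (1 / (1 + ρ) - 1) :=
    Finset.sum_nonneg fun x _ => mul_nonneg (div_nonneg (mul_nonneg (hP x) (hw x)) hq.le)
      (Real.rpow_nonneg (div_nonneg (hw x) hq.le) _)
  rw [hL, Real.mul_rpow (by positivity) hnn, ← Real.rpow_mul hq.le, one_div_mul_cancel hρ1.ne',
    Real.rpow_one]
  refine (mul_le_mul_of_nonneg_left hJ hq.le).trans (le_of_eq ?_)
  rw [Finset.mul_sum]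
  refine Finset.sum_congr rfl fun x _ => ?_
  rw [← Real.rpow_mul (div_nonneg (hw x) hq.le),
    show (1 / (1 + ρ) - 1) * (1 + ρ) = -ρ by field_simp; ring]
  field_simp

theorem gallager_sum_le {X Y : Type*} [Fintype X] [Fintype Y] {W : X → Y → ℝ}
    (hW0 : ∀ x y, 0 ≤ W x y) (hW1 : ∀ x, ∑ y, W x y = 1)
    {P : X → ℝ} (hP0 : ∀ x, 0 ≤ P x) (hP1 : ∑ x, P x = 1)
    (hQ1 : ∑ y, ∑ x, P x * W x y = 1) {ρ : ℝ} (h0 : 0 ≤ ρ) (h1 : ρ ≤ 1 / 2) :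
    ∑ y, (∑ x, P x * W x y ^ (1 / (1 + ρ))) ^ (1 + ρ) ≤
      1 - ρ * (∑ x, ∑ y, P x * W x y * Real.log (W x y / ∑ x', P x' * W x' y)) +
        ρ ^ 2 / 2 * (21 / 25 +
          ∑ y, (∑ x, P x * W x y) * Real.log (∑ x, P x * W x y) ^ 2) := by
  have hWle : ∀ x y, W x y ≤ 1 := fun x y =>
    hW1 x ▸ Finset.single_le_sum (fun y _ => hW0 x y) (Finset.mem_univ y)
  have hy : ∀ y, (∑ x, P x * W x y ^ (1 / (1 + ρ))) ^ (1 + ρ) ≤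
      ∑ x, P x * W x y -
        ρ * ∑ x, P x * W x y * Real.log (W x y / ∑ x', P x' * W x' y) +
        ρ ^ 2 / 2 * (21 / 25 * (∑ x, P x * W x y) +
          (∑ x, P x * W x y) * Real.log (∑ x, P x * W x y) ^ 2) := by
    intro y
    have hPW : ∀ x ∈ Finset.univ, 0 ≤ P x * W x y := fun x _ => mul_nonneg (hP0 x) (hW0 x y)
    rcases (Finset.sum_nonneg hPW).eq_or_lt with h | h
    · have hz : ∀ x, P x * W x y = 0 := fun x =>
        (Finset.sum_eq_zero_iff_of_nonneg hPW).1 h.symm x (Finset.mem_univ x)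
      have hz' : ∀ x, P x * W x y ^ (1 / (1 + ρ)) = 0 := fun x => by
        rcases mul_eq_zero.1 (hz x) with h | h
        · simp [h]
        · rw [h, Real.zero_rpow (by positivity), mul_zero]
      simp only [hz, hz', Finset.sum_const_zero]
      rw [Real.zero_rpow (by linarith)]
      simp
    · refine (rpow_sum_le_sum_mul_rpow hP0 (fun x => hW0 x y) h0 h).trans ?_
      set q := ∑ x, P x * W x y with hq
      refine (Finset.sum_le_sum fun x _ => mul_le_mul_of_nonneg_left
        (mul_rpow_neg_le (hW0 x y) (hWle x y) h h0 h1) (hP0 x)).trans (le_of_eq ?_)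
      have hsplit : ∀ x, P x * (W x y - ρ * (W x y * Real.log (W x y / q)) +
            ρ ^ 2 / 2 * (21 / 25 * q + W x y * Real.log q ^ 2)) =
          P x * W x y - ρ * (P x * W x y * Real.log (W x y / q)) +
            (P x * (ρ ^ 2 / 2 * (21 / 25 * q)) +
              P x * W x y * (ρ ^ 2 / 2 * Real.log q ^ 2)) := fun x => by ring
      simp only [hsplit]
      rw [Finset.sum_add_distrib, Finset.sum_sub_distrib, Finset.sum_add_distrib,
        ← Finset.mul_sum, ← Finset.sum_mul, ← Finset.sum_mul, hP1, ← hq]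
      ring
  refine (Finset.sum_le_sum fun y _ => hy y).trans (le_of_eq ?_)
  rw [Finset.sum_add_distrib, Finset.sum_sub_distrib, ← Finset.mul_sum, ← Finset.mul_sum,
    Finset.sum_add_distrib, ← Finset.mul_sum, hQ1, mul_one,
    Finset.sum_comm (f := fun x y => P x * W x y * Real.log (W x y / ∑ x', P x' * W x' y))]

theorem sum_sq_le_gallager_sum {X Y : Type*} [Fintype X] [Fintype Y] {W : X → Y → ℝ}
    (hW0 : ∀ x y, 0 ≤ W x y) (hW1 : ∀ x, ∑ y, W x y = 1)
    {P : X → ℝ} (hP0 : ∀ x, 0 ≤ P x)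
    (hQ1 : ∑ y, ∑ x, P x * W x y = 1) {ρ : ℝ} (h0 : 0 ≤ ρ) (h1 : ρ ≤ 1) :
    ∑ y, (∑ x, P x * W x y) ^ 2 ≤
      ∑ y, (∑ x, P x * W x y ^ (1 / (1 + ρ))) ^ (1 + ρ) := by
  refine Finset.sum_le_sum fun y _ => ?_
  have hQ0 : ∀ y, 0 ≤ ∑ x, P x * W x y := fun y =>
    Finset.sum_nonneg fun x _ => mul_nonneg (hP0 x) (hW0 x y)
  have hQle : ∑ x, P x * W x y ≤ 1 :=
    hQ1 ▸ Finset.single_le_sum (fun y _ => hQ0 y) (Finset.mem_univ y)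
  have hmono : ∑ x, P x * W x y ≤ ∑ x, P x * W x y ^ (1 / (1 + ρ)) :=
    Finset.sum_le_sum fun x _ => mul_le_mul_of_nonneg_left
      (Real.self_le_rpow_of_le_one (hW0 x y)
        (hW1 x ▸ Finset.single_le_sum (fun y _ => hW0 x y) (Finset.mem_univ y))
        (by rw [div_le_one (by linarith)]; linarith)) (hP0 x)
  calc (∑ x, P x * W x y) ^ 2 = (∑ x, P x * W x y) ^ (2 : ℝ) := (Real.rpow_two _).symm
    _ ≤ (∑ x, P x * W x y) ^ (1 + ρ) :=
      Real.rpow_le_rpow_of_exponent_ge_of_imp (hQ0 y) hQle (by linarith) (by intros; linarith)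
    _ ≤ _ := Real.rpow_le_rpow (hQ0 y) hmono (by linarith)


/-- **Quadratic lower bound on Gallager's random coding error exponent.**
For a DMC with capacity-achieving input distribution `P` (capacity `C` in nats),
`E_p(R) = max_{0≤ρ≤1} [E₀(ρ,P) − ρR]` satisfies
`E_p(R) ≥ (C−R)² / (8/e² + 4 (ln |Y|)²)` for all `R ∈ [0, C]`. -/
theorem gallager_exponent_quadratic_bound
    {X Y : Type*} [Fintype X] [Fintype Y]
    (W : X → Y → ℝ) (hW0 : ∀ x y, 0 ≤ W x y) (hW1 : ∀ x, ∑ y, W x y = 1)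
    (P : X → ℝ) (hP0 : ∀ x, 0 ≤ P x) (hP1 : ∑ x, P x = 1)
    (C : ℝ)
    (hC : C = ∑ x, ∑ y, P x * W x y * Real.log (W x y / ∑ x', P x' * W x' y))
    (hCap : ∀ P' : X → ℝ, (∀ x, 0 ≤ P' x) → (∑ x, P' x = 1) →
      (∑ x, ∑ y, P' x * W x y * Real.log (W x y / ∑ x', P' x' * W x' y)) ≤ C)
    (E0 : ℝ → ℝ)
    (hE0 : ∀ ρ : ℝ, E0 ρ =
      -Real.log (∑ y, (∑ x, P x * W x y ^ (1 / (1 + ρ))) ^ (1 + ρ)))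
    (Ep : ℝ → ℝ)
    (hEp : ∀ R : ℝ, Ep R = sSup {v : ℝ | ∃ ρ ∈ Set.Icc (0:ℝ) 1, v = E0 ρ - ρ * R}) :
    ∀ R : ℝ, 0 ≤ R → R ≤ C →
      (C - R) ^ 2 / (8 / Real.exp 1 ^ 2 + 4 * Real.log (Fintype.card Y) ^ 2) ≤ Ep R := by
  intro R hR0 hRC
  have hQ1 : ∑ y, ∑ x, P x * W x y = 1 := by
    rw [Finset.sum_comm]
    simp only [← Finset.mul_sum, hW1, mul_one, hP1]
  have hQ0 : ∀ y, 0 ≤ ∑ x, P x * W x y := fun y =>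
    Finset.sum_nonneg fun x _ => mul_nonneg (hP0 x) (hW0 x y)
  obtain ⟨y₀, hy₀⟩ : ∃ y, ∑ x, P x * W x y ≠ 0 := by
    by_contra! h
    simp [h] at hQ1
  have hcard : 0 < Fintype.card Y := Fintype.card_pos_iff.2 ⟨y₀⟩
  have hsq : 0 < ∑ y, (∑ x, P x * W x y) ^ 2 :=
    Finset.sum_pos' (fun y _ => sq_nonneg _) ⟨y₀, Finset.mem_univ _, by positivity⟩
  have hbdd : BddAbove {v : ℝ | ∃ ρ ∈ Set.Icc (0:ℝ) 1, v = E0 ρ - ρ * R} := by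
    refine ⟨-Real.log (∑ y, (∑ x, P x * W x y) ^ 2), ?_⟩
    rintro v ⟨ρ, ⟨h0, h1⟩, rfl⟩
    have := Real.log_le_log hsq (sum_sq_le_gallager_sum hW0 hW1 hP0 hQ1 h0 h1)
    rw [hE0]
    linarith [mul_nonneg h0 hR0]
  suffices h : ∃ ρ ∈ Set.Icc (0:ℝ) 1,
      (C - R) ^ 2 / (8 / Real.exp 1 ^ 2 + 4 * Real.log (Fintype.card Y) ^ 2) ≤ E0 ρ - ρ * R by
    obtain ⟨ρ, hρ, hle⟩ := h
    rw [hEp]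
    exact hle.trans (le_csSup hbdd ⟨ρ, hρ, rfl⟩)
  rcases hRC.eq_or_lt with rfl | hlt
  · exact ⟨0, by simp, by simp [hE0, hQ1]⟩
  have hCL : C ≤ Real.log (Fintype.card Y) := hC ▸ sum_mul_log_div_le hW0 hW1 hP0 hQ1 hcard
  have hcard2 : 2 ≤ Fintype.card Y := by
    by_contra! h
    obtain h : Fintype.card Y = 1 := by omega
    rw [h] at hCL
    norm_num at hCL
    linarith
  have hK := sum_mul_log_sq_le hQ0 hQ1 hcard2
  have he := four_div_exp_one_sq_ge
  rw [show 8 / Real.exp 1 ^ 2 + 4 * Real.log (Fintype.card Y) ^ 2 =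
    2 * (4 / Real.exp 1 ^ 2 + 2 * Real.log (Fintype.card Y) ^ 2) by ring]
  set L := Real.log (Fintype.card Y)
  set K := 4 / Real.exp 1 ^ 2 + 2 * L ^ 2 with hKdef
  have hKpos : 0 < K := by positivity
  have hρ0 : 0 ≤ (C - R) / K := div_nonneg (by linarith) hKpos.le
  have hρ1 : (C - R) / K ≤ 1 / 2 := by
    rw [div_le_iff₀ hKpos]
    nlinarith [sq_nonneg (2 * L - 1)]
  refine ⟨(C - R) / K, ⟨hρ0, by linarith⟩, ?_⟩
  have hF := gallager_sum_le hW0 hW1 hP0 hP1 hQ1 hρ0 hρ1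
  have hFpos := hsq.trans_le (sum_sq_le_gallager_sum hW0 hW1 hP0 hQ1 hρ0 (by linarith))
  have hlog := Real.log_le_sub_one_of_pos hFpos
  rw [← hC] at hF
  have hF2 := mul_le_mul_of_nonneg_left hK (by positivity : 0 ≤ ((C - R) / K) ^ 2 / 2)
  have hval : (C - R) ^ 2 / (2 * K) = (C - R) / K * (C - R) - ((C - R) / K) ^ 2 / 2 * K := by
    field_simp; ring
  rw [hE0, hval]
  linarith
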